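/- arXiv:2106.04255 — 2 statements merged into one kernel-verified Lean document; each statement's English description precedes it below -/
import Mathlib

section
/- In the shared-face setting, let 0 ≤ r ≤ d, let p(v) = Σ_{i+j+k+l=d} γ_{ijkl} B^{d,T}_{ijkl}(v) and p̃(v) = Σ_{i+j+k+l=d} γ̃_{ijkl} B^{d,T̃}_{ijkl}(v). Then the following are equivalent: (i) for every w ∈ F, every m = 0,…,r, and every direction u ∈ ℝ³, D_u^m p(w) = D_u^m p̃(w); (ii) for every m = 0,…,r and all nonnegative integers i,j,k with i+j+k = d−m, γ̃_{m,i,j,k} = Σ_{ν+μ+κ+δ=m} γ_{ν, i+μ, k+κ, j+δ} · B^{m,T}_{νμκδ}(v₅), where B^{m,T}_{νμκδ}(v₅) is computed from the barycentric coordinates of v₅ relative to T. -/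
/-- The directional derivative `D_u f (v) = (d/dt) f(v + t u)|_{t=0}`; its `m`-th iterate
`(dirDeriv u)^[m]` is the `m`-th directional derivative `D_u^m`. -/
noncomputable def dirDeriv (u : Fin 3 → ℝ) (f : (Fin 3 → ℝ) → ℝ) : (Fin 3 → ℝ) → ℝ :=
  fun v => deriv (fun t : ℝ => f (v + t • u)) 0

/-- A polynomial in Bernstein form, as a function of the barycentric coordinates. -/
noncomputable def Bern (d : ℕ) (γ : (Fin 4 → ℕ) → ℝ) (x : Fin 4 → ℝ) : ℝ :=
  ∑ ind ∈ Finset.Nat.antidiagonalTuple 4 d,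
    γ ind * ((Nat.multinomial Finset.univ ind : ℝ) * ∏ t, x t ^ ind t)

/-- The linear functional sending the monomial with exponent `s` to `γ s`. -/
noncomputable def Lam (γ : (Fin 4 → ℕ) → ℝ) : MvPolynomial (Fin 4) ℝ →ₗ[ℝ] ℝ :=
  (MvPolynomial.basisMonomials (Fin 4) ℝ).constr ℝ (fun s => γ s)

lemma Lam_monomial (γ : (Fin 4 → ℕ) → ℝ) (s : Fin 4 →₀ ℕ) (c : ℝ) :
    Lam γ (MvPolynomial.monomial s c) = c * γ s := by
  have h : Lam γ (MvPolynomial.monomial s 1) = γ s := by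
    have := (MvPolynomial.basisMonomials (Fin 4) ℝ).constr_basis ℝ (fun s => γ s) s
    simpa [Lam, MvPolynomial.coe_basisMonomials] using this
  have h2 : MvPolynomial.monomial s c = c • (MvPolynomial.monomial s (1 : ℝ)) := by
    rw [MvPolynomial.smul_monomial, smul_eq_mul, mul_one]
  rw [h2, map_smul, h, smul_eq_mul]

lemma piAnti_eq (d : ℕ) :
    Finset.piAntidiag (Finset.univ : Finset (Fin 4)) d = Finset.Nat.antidiagonalTuple 4 d := by
  ext f
  simp [Finset.Nat.mem_antidiagonalTuple]

lemma prod_C_X (x : Fin 4 → ℝ) (e : Fin 4 → ℕ) :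
    ∏ t, (MvPolynomial.C (x t) * MvPolynomial.X t : MvPolynomial (Fin 4) ℝ) ^ e t =
      MvPolynomial.monomial (Finsupp.equivFunOnFinite.symm e) (∏ t, x t ^ e t) := by
  rw [MvPolynomial.monomial_eq, Finsupp.prod_fintype _ _ (by simp)]
  simp [mul_pow, Finset.prod_mul_distrib]

lemma Lam_pow (γ : (Fin 4 → ℕ) → ℝ) (d : ℕ) (x : Fin 4 → ℝ) (s : Fin 4 →₀ ℕ) :
    Lam γ ((∑ t, MvPolynomial.C (x t) * MvPolynomial.X t) ^ d * MvPolynomial.monomial s 1) =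
      Bern d (fun e => γ (e + s)) x := by
  rw [Finset.sum_pow_eq_sum_piAntidiag, piAnti_eq, Finset.sum_mul, map_sum, Bern]
  refine Finset.sum_congr rfl fun e _ => ?_
  rw [prod_C_X, mul_assoc, MvPolynomial.monomial_mul, ← nsmul_eq_mul, map_nsmul, Lam_monomial]
  simp only [nsmul_eq_mul, mul_one, Finsupp.coe_add, Finsupp.coe_equivFunOnFinite_symm]
  ring_nf

/-- Change of barycentric coordinates in Bernstein form. -/
lemma Bern_star (γ : (Fin 4 → ℕ) → ℝ) (d : ℕ) (τ x : Fin 4 → ℝ) :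
    Bern d γ (fun t => x 0 * τ t + ![0, x 1, x 3, x 2] t) =
      Bern d (fun f => ∑ e ∈ Finset.Nat.antidiagonalTuple 4 (f 0),
            γ ![e 0, f 1 + e 1, f 3 + e 2, f 2 + e 3] *
              ((Nat.multinomial Finset.univ e : ℝ) * ∏ t, τ t ^ e t)) x := by
  have h0 := Lam_pow γ d (fun t => x 0 * τ t + ![0, x 1, x 3, x 2] t) 0
  simp only [Finsupp.coe_zero, add_zero, MvPolynomial.monomial_zero', map_one, mul_one] at h0
  rw [← h0]
  have h1 : (∑ t, MvPolynomial.C (x 0 * τ t + ![0, x 1, x 3, x 2] t) * MvPolynomial.X t :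
        MvPolynomial (Fin 4) ℝ) =
      ∑ t, ![MvPolynomial.C (x 0) * (∑ t, MvPolynomial.C (τ t) * MvPolynomial.X t),
        MvPolynomial.C (x 1) * MvPolynomial.X 1, MvPolynomial.C (x 2) * MvPolynomial.X 3,
        MvPolynomial.C (x 3) * MvPolynomial.X 2] t := by
    simp [Fin.sum_univ_four]
    ring
  rw [h1, Finset.sum_pow_eq_sum_piAntidiag, piAnti_eq, map_sum, Bern]
  refine Finset.sum_congr rfl fun f _ => ?_
  have h2 : (∏ i, ![MvPolynomial.C (x 0) * (∑ t, MvPolynomial.C (τ t) * MvPolynomial.X t),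
        MvPolynomial.C (x 1) * MvPolynomial.X 1, MvPolynomial.C (x 2) * MvPolynomial.X 3,
        MvPolynomial.C (x 3) * MvPolynomial.X 2] i ^ f i : MvPolynomial (Fin 4) ℝ) =
      (∏ t, x t ^ f t) • ((∑ t, MvPolynomial.C (τ t) * MvPolynomial.X t) ^ f 0 *
        MvPolynomial.monomial (Finsupp.equivFunOnFinite.symm ![0, f 1, f 3, f 2]) 1) := by
    rw [MvPolynomial.monomial_eq, Finsupp.prod_fintype _ _ (by simp), MvPolynomial.smul_eq_C_mul]
    simp only [Fin.prod_univ_four, Finsupp.coe_equivFunOnFinite_symm, map_mul, map_pow,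
      mul_pow]
    simp
    ring
  rw [h2, ← nsmul_eq_mul, map_nsmul, map_smul, Lam_pow, Bern, nsmul_eq_mul, smul_eq_mul]
  have h3 : ∀ e : Fin 4 → ℕ, (e + ⇑(Finsupp.equivFunOnFinite.symm ![0, f 1, f 3, f 2]) : Fin 4 → ℕ)
      = ![e 0, f 1 + e 1, f 3 + e 2, f 2 + e 3] := by
    intro e
    funext t
    fin_cases t <;> simp [add_comm]
  simp only [h3]
  ring

lemma dirDeriv_iter (u : Fin 3 → ℝ) (F : (Fin 3 → ℝ) → ℝ) (w : Fin 3 → ℝ) (m : ℕ) (t : ℝ) :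
    (dirDeriv u)^[m] F (w + t • u) = iteratedDeriv m (fun t : ℝ => F (w + t • u)) t := by
  induction m generalizing t with
  | zero => simp
  | succ m ih =>
    rw [Function.iterate_succ_apply', iteratedDeriv_succ, dirDeriv]
    have : (fun s : ℝ => (dirDeriv u)^[m] F (w + t • u + s • u)) =
        fun s => iteratedDeriv m (fun t : ℝ => F (w + t • u)) (t + s) := by
      funext s
      rw [← ih, add_smul, add_assoc]
    rw [this, deriv_comp_const_add, add_zero]

lemma dirDeriv_poly (u : Fin 3 → ℝ) (F : (Fin 3 → ℝ) → ℝ) (w : Fin 3 → ℝ) (m : ℕ)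
    (P : Polynomial ℝ) (h : ∀ t : ℝ, F (w + t • u) = P.eval t) :
    (dirDeriv u)^[m] F w = m.factorial * P.coeff m := by
  have h1 := dirDeriv_iter u F w m 0
  rw [zero_smul, add_zero] at h1
  rw [h1, funext h]
  have h2 : ∀ (k : ℕ), iteratedDeriv k (fun t => P.eval t) =
      fun t => (Polynomial.derivative^[k] P).eval t := by
    intro k
    induction k with
    | zero => simp
    | succ k ih =>
      rw [iteratedDeriv_succ, ih, Function.iterate_succ_apply']
      funext t
      exact Polynomial.deriv _
  rw [h2]
  simp only
  rw [← Polynomial.coeff_zero_eq_eval_zero, Polynomial.coeff_iterate_derivative]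
  simp [Nat.descFactorial_self]

lemma bary_unique {p : Fin 4 → Fin 3 → ℝ} (hp : AffineIndependent ℝ p) (a b : Fin 4 → ℝ)
    (ha : ∑ i, a i = 1) (hb : ∑ i, b i = 1) (hab : ∑ i, a i • p i = ∑ i, b i • p i) : a = b := by
  rw [affineIndependent_iff] at hp
  funext i
  have := hp Finset.univ (a - b) (by simp [ha, hb]) (by simp [sub_smul, hab]) i (Finset.mem_univ _)
  simpa [sub_eq_zero] using this

lemma bary_comb {p : Fin 4 → Fin 3 → ℝ} (hp : AffineIndependent ℝ p)
    (bc : (Fin 3 → ℝ) → (Fin 4 → ℝ)) (h1 : ∀ v, ∑ i, bc v i = 1)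
    (h2 : ∀ v, v = ∑ i, bc v i • p i) (x y : Fin 3 → ℝ) (α β : ℝ) (h : α + β = 1) :
    bc (α • x + β • y) = α • bc x + β • bc y := by
  apply bary_unique hp _ _ (h1 _)
  · simp [Finset.sum_add_distrib, ← Finset.mul_sum, h1, h]
  · rw [← h2]
    simp only [Pi.add_apply, Pi.smul_apply, smul_eq_mul, add_smul, mul_smul,
      Finset.sum_add_distrib, ← Finset.smul_sum, ← h2]

lemma Bern_sub (d : ℕ) (γ γ' : (Fin 4 → ℕ) → ℝ) (x : Fin 4 → ℝ) :
    Bern d γ x - Bern d γ' x = Bern d (fun e => γ e - γ' e) x := by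
  simp [Bern, sub_mul]

lemma Bern_poly (d : ℕ) (γ : (Fin 4 → ℕ) → ℝ) (P : Fin 4 → Polynomial ℝ) (t : ℝ) :
    (∑ ind ∈ Finset.Nat.antidiagonalTuple 4 d,
      Polynomial.C (γ ind * (Nat.multinomial Finset.univ ind : ℝ)) * ∏ i, P i ^ ind i).eval t =
    Bern d γ (fun i => (P i).eval t) := by
  simp [Bern, Polynomial.eval_finsetSum, Polynomial.eval_prod, mul_assoc]

/-- If all coefficients with small first index vanish, so do the low order terms. -/
lemma coeff_low (d r : ℕ) (γ : (Fin 4 → ℕ) → ℝ) (P : Fin 4 → Polynomial ℝ)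
    (hP : (P 0).coeff 0 = 0)
    (hγ : ∀ e ∈ Finset.Nat.antidiagonalTuple 4 d, e 0 ≤ r → γ e = 0) (m : ℕ) (hm : m ≤ r) :
    (∑ ind ∈ Finset.Nat.antidiagonalTuple 4 d,
      Polynomial.C (γ ind * (Nat.multinomial Finset.univ ind : ℝ)) *
        ∏ i, P i ^ ind i).coeff m = 0 := by
  rw [Polynomial.finsetSum_coeff]
  refine Finset.sum_eq_zero fun e he => ?_
  by_cases h : e 0 ≤ r
  · simp [hγ e he h]
  · obtain ⟨Q, hQ⟩ := Polynomial.X_dvd_iff.2 hP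
    rw [mul_comm, Polynomial.coeff_mul_C, Fin.prod_univ_four, hQ, mul_pow]
    simp only [mul_assoc]
    rw [Polynomial.coeff_X_pow_mul', if_neg (by omega), zero_mul]

/-- The converse, along rays towards the opposite vertex. -/
lemma coeff_low_conv (d r : ℕ) (Q : ℕ → ℝ) (hr : r ≤ d)
    (h : ∀ m ≤ r, (∑ k ∈ Finset.range (d + 1),
      Polynomial.C (Q k) * (Polynomial.X ^ k * (1 - Polynomial.X) ^ (d - k))).coeff m = 0)
    (m : ℕ) (hm : m ≤ r) : Q m = 0 := by
  induction m using Nat.strong_induction_on with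
  | _ m ih =>
    have h1 := h m hm
    rw [Polynomial.finsetSum_coeff, Finset.sum_eq_single m] at h1
    · simpa [Polynomial.coeff_X_pow_mul', Polynomial.coeff_zero_eq_eval_zero] using h1
    · intro k _ hk
      rcases lt_or_gt_of_ne hk with h2 | h2
      · simp [ih k h2 (by omega)]
      · rw [Polynomial.coeff_C_mul, Polynomial.coeff_X_pow_mul', if_neg (by omega), mul_zero]
    · intro h2
      simp at h2
      omega

lemma mv_zero (d : ℕ) (γ : (Fin 4 → ℕ) → ℝ)
    (h : ∀ x : Fin 4 → ℝ, (∀ i, 0 < x i) → Bern d γ x = 0) :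
    ∀ e ∈ Finset.Nat.antidiagonalTuple 4 d, γ e = 0 := by
  intro e he
  have h1 : (∑ ind ∈ Finset.Nat.antidiagonalTuple 4 d,
      MvPolynomial.monomial (Finsupp.equivFunOnFinite.symm ind)
        (γ ind * (Nat.multinomial Finset.univ ind : ℝ))) = 0 := by
    refine MvPolynomial.funext_set (fun _ => Set.Ioi (0 : ℝ)) (fun _ => Set.Ioi_infinite _) ?_
    intro x hx
    rw [map_zero, ← h x (fun i => hx i trivial), map_sum, Bern]
    refine Finset.sum_congr rfl fun f _ => ?_
    rw [MvPolynomial.eval_monomial, Finsupp.prod_fintype _ _ (by simp)]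
    simp [mul_assoc]
  have h2 := congrArg (MvPolynomial.coeff (Finsupp.equivFunOnFinite.symm e)) h1
  simp only [MvPolynomial.coeff_sum, MvPolynomial.coeff_monomial, MvPolynomial.coeff_zero,
    EmbeddingLike.apply_eq_iff_eq] at h2
  rw [Finset.sum_ite_eq' , if_pos he] at h2
  rcases mul_eq_zero.1 h2 with h3 | h3
  · exact h3
  · exact absurd h3 (by exact_mod_cast (Nat.multinomial_pos _ _).ne')

lemma low_zero (d r : ℕ) (hr : r ≤ d) (D : (Fin 4 → ℕ) → ℝ)
    (h : ∀ a : Fin 3 → ℝ, (∀ i, 0 ≤ a i) → ∑ i, a i = 1 → ∀ m ≤ r,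
      (∑ ind ∈ Finset.Nat.antidiagonalTuple 4 d,
        Polynomial.C (D ind * (Nat.multinomial Finset.univ ind : ℝ)) *
          ∏ i, (![Polynomial.X, Polynomial.C (a 0) * (1 - Polynomial.X),
            Polynomial.C (a 1) * (1 - Polynomial.X),
            Polynomial.C (a 2) * (1 - Polynomial.X)] i : Polynomial ℝ) ^ ind i).coeff m = 0) :
    ∀ e ∈ Finset.Nat.antidiagonalTuple 4 d, e 0 ≤ r → D e = 0 := by
  intro e he her
  have key := mv_zero d (fun e => if e 0 ≤ r then D e else 0) ?_ e he
  · simpa [her] using key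
  intro x hx
  have hmap : ∀ f ∈ Finset.Nat.antidiagonalTuple 4 d, f 0 ∈ Finset.range (d + 1) := by
    intro f hf
    rw [Finset.Nat.mem_antidiagonalTuple, Fin.sum_univ_four] at hf
    rw [Finset.mem_range]
    omega
  have hσ : 0 < x 1 + x 2 + x 3 := by
    have := hx 1
    have := hx 2
    have := hx 3
    positivity
  set σ := x 1 + x 2 + x 3 with hσd
  set Q : ℕ → ℝ := fun k => ∑ f ∈ Finset.Nat.antidiagonalTuple 4 d with f 0 = k,
    D f * (Nat.multinomial Finset.univ f : ℝ) *
      ((x 1 / σ) ^ f 1 * (x 2 / σ) ^ f 2 * (x 3 / σ) ^ f 3) with hQ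
  have hQ0 : ∀ m ≤ r, Q m = 0 := by
    intro m hm
    refine coeff_low_conv d r Q hr ?_ m hm
    intro m hm
    have h1 := h ![x 1 / σ, x 2 / σ, x 3 / σ] ?_ ?_ m hm
    · rw [← h1]
      congr 1
      rw [← Finset.sum_fiberwise_of_maps_to hmap]
      refine Finset.sum_congr rfl fun k hk => ?_
      rw [hQ, map_sum, Finset.sum_mul]
      refine Finset.sum_congr rfl fun f hf => ?_
      rw [Finset.mem_filter, Finset.Nat.mem_antidiagonalTuple, Fin.sum_univ_four] at hf
      have : d - k = f 1 + f 2 + f 3 := by omega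
      rw [this, ← hf.2, Fin.prod_univ_four]
      simp only [map_mul, map_pow, Matrix.cons_val, mul_pow, pow_add]
      ring
    · intro i
      have := (hx 1).le
      have := (hx 2).le
      have := (hx 3).le
      fin_cases i <;> simp <;> positivity
    · rw [Fin.sum_univ_three]
      simp only [Matrix.cons_val]
      field_simp
      exact hσd.symm
  rw [Bern, ← Finset.sum_fiberwise_of_maps_to hmap]
  refine Finset.sum_eq_zero fun k hk => ?_
  by_cases hkr : k ≤ r
  · have h2 : x 0 ^ k * σ ^ (d - k) * Q k = 0 := by rw [hQ0 k hkr, mul_zero]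
    rw [← h2, hQ, Finset.mul_sum]
    refine Finset.sum_congr rfl fun f hf => ?_
    rw [Finset.mem_filter, Finset.Nat.mem_antidiagonalTuple, Fin.sum_univ_four] at hf
    have : d - k = f 1 + f 2 + f 3 := by omega
    rw [this, if_pos (by omega), Fin.prod_univ_four, hf.2]
    simp only [div_pow, pow_add]
    field_simp
  · refine Finset.sum_eq_zero fun f hf => ?_
    rw [Finset.mem_filter] at hf
    rw [if_neg (by omega), zero_mul]

theorem stmt_10 (v1 v2 v3 v4 v5 : Fin 3 → ℝ)
    (hT : AffineIndependent ℝ ![v2, v1, v3, v4])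
    (hT' : AffineIndependent ℝ ![v5, v1, v4, v3])
    (bc bct : (Fin 3 → ℝ) → (Fin 4 → ℝ))
    (hbc1 : ∀ v, ∑ i, bc v i = 1) (hbc2 : ∀ v, v = ∑ i, bc v i • ![v2, v1, v3, v4] i)
    (hbct1 : ∀ v, ∑ i, bct v i = 1) (hbct2 : ∀ v, v = ∑ i, bct v i • ![v5, v1, v4, v3] i)
    (d r : ℕ) (hr : r ≤ d) (γ γ' : (Fin 4 → ℕ) → ℝ) :
    (∀ w ∈ convexHull ℝ ({v1, v3, v4} : Set (Fin 3 → ℝ)), ∀ m : ℕ, m ≤ r →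
        ∀ u : Fin 3 → ℝ,
        (dirDeriv u)^[m]
            (fun x => ∑ ind ∈ Finset.Nat.antidiagonalTuple 4 d,
              γ ind * ((Nat.multinomial Finset.univ ind : ℝ) * ∏ t, bc x t ^ ind t)) w =
          (dirDeriv u)^[m]
            (fun x => ∑ ind ∈ Finset.Nat.antidiagonalTuple 4 d,
              γ' ind * ((Nat.multinomial Finset.univ ind : ℝ) * ∏ t, bct x t ^ ind t)) w) ↔
      (∀ m : ℕ, m ≤ r → ∀ i j k : ℕ, i + j + k = d - m →
        γ' ![m, i, j, k] =
          ∑ e ∈ Finset.Nat.antidiagonalTuple 4 m,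
            γ ![e 0, i + e 1, k + e 2, j + e 3] *
              ((Nat.multinomial Finset.univ e : ℝ) * ∏ t, bc v5 t ^ e t)) := by
  set G : (Fin 4 → ℕ) → ℝ := fun f => ∑ e ∈ Finset.Nat.antidiagonalTuple 4 (f 0),
            γ ![e 0, f 1 + e 1, f 3 + e 2, f 2 + e 3] *
              ((Nat.multinomial Finset.univ e : ℝ) * ∏ t, bc v5 t ^ e t) with hG
  set D : (Fin 4 → ℕ) → ℝ := fun e => G e - γ' e with hD
  -- the relation between the two systems of barycentric coordinates
  have hbcx : ∀ x, bc x = fun t => bct x 0 * bc v5 t + ![0, bct x 1, bct x 3, bct x 2] t := by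
    intro x
    have h5 := hbc1 v5
    have hx1 := hbct1 x
    have hx2 := hbct2 x
    have h52 := hbc2 v5
    apply bary_unique hT _ _ (hbc1 x)
    · rw [Fin.sum_univ_four] at h5 hx1 ⊢
      simp only [Matrix.cons_val]
      linear_combination bct x 0 * h5 + hx1
    · rw [← hbc2 x]
      rw [Fin.sum_univ_four] at h52 hx2 ⊢
      simp only [Matrix.cons_val] at h52 hx2 ⊢
      funext c
      have e1 := congrFun h52 c
      have e2 := congrFun hx2 c
      simp only [Pi.add_apply, Pi.smul_apply, smul_eq_mul] at e1 e2 ⊢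
      linear_combination e2 + bct x 0 * e1
  have hq : ∀ x, Bern d γ (bc x) - Bern d γ' (bct x) = Bern d D (bct x) := by
    intro x
    rw [hbcx x, Bern_star, Bern_sub]
  -- restriction to lines
  set L : ((Fin 3 → ℝ) → (Fin 4 → ℝ)) → (Fin 3 → ℝ) → (Fin 3 → ℝ) → Fin 4 → Polynomial ℝ :=
    fun b w u i => Polynomial.C (b w i) +
      Polynomial.X * Polynomial.C (b (w + u) i - b w i) with hL
  have hline : ∀ w u : Fin 3 → ℝ, ∀ t : ℝ, w + t • u = (1 - t) • w + t • (w + u) := by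
    intro w u t
    module
  have hLbc : ∀ w u t, bc (w + t • u) = fun i => (L bc w u i).eval t := by
    intro w u t
    rw [hline, bary_comb hT bc hbc1 hbc2 _ _ _ _ (by ring)]
    funext i
    simp [hL]
    ring
  have hLbct : ∀ w u t, bct (w + t • u) = fun i => (L bct w u i).eval t := by
    intro w u t
    rw [hline, bary_comb hT' bct hbct1 hbct2 _ _ _ _ (by ring)]
    funext i
    simp [hL]
    ring
  set R : ((Fin 4 → ℕ) → ℝ) → (Fin 4 → Polynomial ℝ) → Polynomial ℝ := fun c P =>
    ∑ ind ∈ Finset.Nat.antidiagonalTuple 4 d,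
      Polynomial.C (c ind * (Nat.multinomial Finset.univ ind : ℝ)) * ∏ i, P i ^ ind i with hR
  have hRsub : ∀ w u, R γ (L bc w u) - R γ' (L bct w u) = R D (L bct w u) := by
    intro w u
    refine Polynomial.funext fun t => ?_
    rw [Polynomial.eval_sub, hR, Bern_poly, Bern_poly, Bern_poly, ← hLbc, ← hLbct, hq]
  have step : ∀ w u (m : ℕ), ((dirDeriv u)^[m] (fun x => Bern d γ (bc x)) w =
      (dirDeriv u)^[m] (fun x => Bern d γ' (bct x)) w) ↔ (R D (L bct w u)).coeff m = 0 := by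
    intro w u m
    rw [dirDeriv_poly u (fun x => Bern d γ (bc x)) w m (R γ (L bc w u))
        (fun t => by rw [hR, Bern_poly, hLbc]),
      dirDeriv_poly u (fun x => Bern d γ' (bct x)) w m (R γ' (L bct w u))
        (fun t => by rw [hR, Bern_poly, hLbct]), ← hRsub, Polynomial.coeff_sub, sub_eq_zero]
    have : (m.factorial : ℝ) ≠ 0 := by exact_mod_cast m.factorial_ne_zero
    exact mul_right_inj' this
  -- the algebraic condition
  have hii : (∀ m : ℕ, m ≤ r → ∀ i j k : ℕ, i + j + k = d - m →
        γ' ![m, i, j, k] =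
          ∑ e ∈ Finset.Nat.antidiagonalTuple 4 m,
            γ ![e 0, i + e 1, k + e 2, j + e 3] *
              ((Nat.multinomial Finset.univ e : ℝ) * ∏ t, bc v5 t ^ e t)) ↔
      ∀ e ∈ Finset.Nat.antidiagonalTuple 4 d, e 0 ≤ r → D e = 0 := by
    constructor
    · intro h e he her
      rw [Finset.Nat.mem_antidiagonalTuple, Fin.sum_univ_four] at he
      have h1 := h (e 0) her (e 1) (e 2) (e 3) (by omega)
      have h2 : e = ![e 0, e 1, e 2, e 3] := by
        funext t
        fin_cases t <;> rfl
      rw [← h2] at h1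
      rw [hD, hG]
      simp only
      rw [h1, sub_self]
    · intro h m hm i j k hijk
      have h1 := h ![m, i, j, k] (by
        rw [Finset.Nat.mem_antidiagonalTuple, Fin.sum_univ_four]
        simp only [Matrix.cons_val]
        omega) hm
      rw [hD, hG] at h1
      exact (sub_eq_zero.1 h1).symm
  rw [hii]
  constructor
  · intro h
    refine low_zero d r hr D fun a ha ha1 m hm => ?_
    rw [Fin.sum_univ_three] at ha1
    set w : Fin 3 → ℝ := a 0 • v1 + a 1 • v4 + a 2 • v3 with hw
    have hwF : w ∈ convexHull ℝ ({v1, v3, v4} : Set (Fin 3 → ℝ)) := by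
      have := (convex_convexHull ℝ ({v1, v3, v4} : Set (Fin 3 → ℝ))).sum_mem
        (t := Finset.univ) (w := a) (z := ![v1, v4, v3]) (fun i _ => ha i)
        (by rw [Fin.sum_univ_three, ha1])
        (fun i _ => subset_convexHull ℝ _ (by fin_cases i <;> simp))
      rw [Fin.sum_univ_three] at this
      exact this
    have hbw : bct w = ![0, a 0, a 1, a 2] := by
      apply bary_unique hT' _ _ (hbct1 w)
      · rw [Fin.sum_univ_four]
        simp only [Matrix.cons_val]
        linarith
      · rw [← hbct2 w, Fin.sum_univ_four]
        simp [hw]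
    have hb5 : bct v5 = ![1, 0, 0, 0] := by
      apply bary_unique hT' _ _ (hbct1 v5)
      · simp [Fin.sum_univ_four]
      · rw [← hbct2 v5, Fin.sum_univ_four]
        simp
    have h1 := (step w (v5 - w) m).1 (h w hwF m hm (v5 - w))
    have h2 : L bct w (v5 - w) = ![Polynomial.X, Polynomial.C (a 0) * (1 - Polynomial.X),
            Polynomial.C (a 1) * (1 - Polynomial.X),
            Polynomial.C (a 2) * (1 - Polynomial.X)] := by
      funext i
      simp only [hL, add_sub_cancel, hbw, hb5]
      fin_cases i <;> simp <;> ring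
    rw [h2] at h1
    exact h1
  · intro h w hw m hm u
    refine (step w u m).2 (coeff_low d r D _ ?_ h m hm)
    have hw0 : bct w 0 = 0 := by
      have hsub : ({v1, v3, v4} : Set (Fin 3 → ℝ)) ⊆ {x | bct x 0 = 0} := by
        have e1 : bct v1 = ![0, 1, 0, 0] := by
          apply bary_unique hT' _ _ (hbct1 _)
          · simp [Fin.sum_univ_four]
          · rw [← hbct2, Fin.sum_univ_four]
            simp
        have e4 : bct v4 = ![0, 0, 1, 0] := by
          apply bary_unique hT' _ _ (hbct1 _)
          · simp [Fin.sum_univ_four]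
          · rw [← hbct2, Fin.sum_univ_four]
            simp
        have e3 : bct v3 = ![0, 0, 0, 1] := by
          apply bary_unique hT' _ _ (hbct1 _)
          · simp [Fin.sum_univ_four]
          · rw [← hbct2, Fin.sum_univ_four]
            simp
        rintro x (rfl | rfl | rfl)
        · simp [e1]
        · simp [e3]
        · simp [e4]
      refine convexHull_min hsub ?_ hw
      intro x hx y hy α β _ _ hαβ
      simp only [Set.mem_setOf_eq] at hx hy ⊢
      rw [bary_comb hT' bct hbct1 hbct2 _ _ _ _ hαβ]
      simp [hx, hy]
    simp [hL, hw0]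
end

section
/- Let d ≥ 0 and let (ν,μ,κ,δ) and (ν',μ',κ',δ') be nonnegative multi-indices with ν+μ+κ+δ = d and ν'+μ'+κ'+δ' = d. Then ∫_T B^{d,T}_{νμκδ}(v) · B^{d,T}_{ν'μ'κ'δ'}(v) dv = [binom(ν+ν',ν)·binom(μ+μ',μ)·binom(κ+κ',κ)·binom(δ+δ',δ)] / [binom(2d,d)·binom(2d+3,3)] · vol(T), where the integral is with respect to Lebesgue measure on ℝ³ and vol(T) is the Lebesgue volume of T. -/
open MeasureTheory

lemma beta_aux (s : ℝ) (a : ℕ) : ∀ N : ℕ,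
    ∫ x in (0:ℝ)..s, x ^ a * (s - x) ^ N =
      (a.factorial * N.factorial : ℝ) / ((a + N + 1).factorial : ℝ) * s ^ (a + N + 1) := by
  induction a with
  | zero =>
    intro N
    have h := intervalIntegral.integral_comp_sub_left (fun x : ℝ => x ^ N) (a := 0) (b := s) s
    simp only [pow_zero, one_mul, h]
    have : (N.factorial : ℝ) ≠ 0 := by positivity
    simp [Nat.factorial_succ]
    field_simp
  | succ a ih =>
    intro N
    have h1 : ∀ x ∈ Set.uIcc 0 s, HasDerivAt (fun x : ℝ => x ^ (a+1) * (s - x) ^ (N+1))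
        ((a+1) * (x ^ a * (s - x) ^ (N+1)) - (N+1) * (x ^ (a+1) * (s - x)^N)) x := by
      intro x _
      have := ((hasDerivAt_id x).pow (a+1)).mul (((hasDerivAt_id x).const_sub s).pow (N+1))
      refine this.congr_deriv ?_
      push_cast
      simp
      ring
    have h2 := intervalIntegral.integral_eq_sub_of_hasDerivAt h1
      (Continuous.intervalIntegrable (by fun_prop) _ _)
    rw [intervalIntegral.integral_sub (Continuous.intervalIntegrable (by fun_prop) _ _)
      (Continuous.intervalIntegrable (by fun_prop) _ _), intervalIntegral.integral_const_mul,
      intervalIntegral.integral_const_mul, ih] at h2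
    simp at h2
    have hN : (N + 1 : ℝ) ≠ 0 := by positivity
    apply mul_left_cancel₀ hN
    rw [← sub_eq_zero.mp h2, show a + 1 + N + 1 = a + (N+1) + 1 by ring]
    simp only [Nat.factorial_succ a, Nat.factorial_succ N]
    push_cast
    ring

def Sx (n : ℕ) (s : ℝ) : Set (Fin n → ℝ) := {x | (∀ i, 0 ≤ x i) ∧ ∑ i, x i ≤ s}

lemma Sx_compact (n : ℕ) (s : ℝ) : IsCompact (Sx n s) := by
  apply (isCompact_Icc (a := (0 : Fin n → ℝ)) (b := fun _ => s)).of_isClosed_subset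
  · have : Sx n s = (⋂ i, {x : Fin n → ℝ | 0 ≤ x i}) ∩ {x | ∑ i, x i ≤ s} := by
      ext x; simp [Sx]
    rw [this]
    exact (isClosed_iInter fun i => isClosed_le continuous_const (continuous_apply i)).inter
      (isClosed_le (continuous_finsetSum _ fun i _ => continuous_apply i) continuous_const)
  · rintro x ⟨h, h'⟩
    exact ⟨h, fun i => (Finset.single_le_sum (fun j _ => h j) (Finset.mem_univ i)).trans h'⟩

lemma dirichlet (n : ℕ) : ∀ (s : ℝ) (_ : 0 ≤ s) (a : Fin n → ℕ) (m : ℕ),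
    ∫ x in Sx n s, (∏ i, x i ^ a i) * (s - ∑ i, x i) ^ m =
      ((∏ i, (a i).factorial : ℕ) * m.factorial : ℝ) / ((∑ i, a i + m + n).factorial : ℝ)
        * s ^ (∑ i, a i + m + n) := by
  induction n with
  | zero =>
    intro s hs a m
    have : Sx 0 s = Set.univ := by ext x; simp [Sx, hs]
    have h2 : (m.factorial : ℝ) ≠ 0 := by positivity
    simp [this, h2]
    rw [measureReal_def, volume_pi, Measure.pi_of_empty]
    simp
  | succ n ih =>
    intro s hs a m
    have hme := (volume_preserving_piFinSuccAbove (fun _ : Fin (n+1) => ℝ) 0).symm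
    rw [← integral_indicator (Sx_compact _ _).measurableSet, ← hme.integral_comp',
      Measure.volume_eq_prod, integral_prod]
    · have key : ∀ x : ℝ, (∫ y : Fin n → ℝ, (Sx (n+1) s).indicator (fun x => (∏ i, x i ^ a i) * (s - ∑ i, x i) ^ m)
          ((MeasurableEquiv.piFinSuccAbove (fun _ : Fin (n+1) => ℝ) 0).symm (x, y)))
          = (Set.Icc 0 s).indicator (fun x => (((∏ i : Fin n, (a i.succ).factorial : ℕ) * m.factorial : ℝ) / ((∑ i : Fin n, a i.succ + m + n).factorial : ℝ)) * (x ^ a 0 * (s - x) ^ (∑ i : Fin n, a i.succ + m + n))) x := by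
        intro x
        by_cases hx : x ∈ Set.Icc 0 s
        · rw [Set.indicator_of_mem hx]
          have := ih (s - x) (by linarith [hx.2]) (fun i => a i.succ) m
          rw [mul_left_comm, ← this, ← integral_const_mul, 
            ← integral_indicator (Sx_compact _ _).measurableSet]
          congr 1
          ext y
          have hiff : (MeasurableEquiv.piFinSuccAbove (fun _ : Fin (n+1) => ℝ) 0).symm (x, y) ∈ Sx (n+1) s
            ↔ y ∈ Sx n (s - x) := by
            simp only [Sx, Set.mem_ofPred_eq, Fin.forall_fin_succ, Fin.sum_univ_succ]
            simp [hx.1, le_sub_iff_add_le']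
          by_cases hy : y ∈ Sx n (s - x)
          · rw [Set.indicator_of_mem hy, Set.indicator_of_mem (hiff.2 hy)]
            simp [Fin.sum_univ_succ, Fin.prod_univ_succ]
            ring
          · rw [Set.indicator_of_notMem hy, Set.indicator_of_notMem (hiff.not.2 hy)]
        · rw [Set.indicator_of_notMem hx]
          rw [← integral_zero (Fin n → ℝ) ℝ]
          congr 1
          ext y
          apply Set.indicator_of_notMem
          contrapose! hx
          simp only [Sx, Set.mem_ofPred_eq, Fin.forall_fin_succ, Fin.sum_univ_succ] at hx
          simp at hx
          have := Finset.sum_nonneg (s := Finset.univ) fun j _ => hx.1.2 j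
          exact ⟨hx.1.1, by linarith⟩
      simp_rw [key]
      rw [integral_indicator measurableSet_Icc, integral_Icc_eq_integral_Ioc,
        ← intervalIntegral.integral_of_le hs, intervalIntegral.integral_const_mul, beta_aux]
      rw [Fin.sum_univ_succ, Fin.prod_univ_succ, show a 0 + (∑ i : Fin n, a i.succ + m + n) + 1 =
        a 0 + ∑ i : Fin n, a i.succ + m + (n + 1) by ring]
      have : ((∑ i : Fin n, a i.succ + m + n).factorial : ℝ) ≠ 0 := by positivity
      push_cast
      field_simp
    · have : Integrable ((Sx (n+1) s).indicator (fun x => (∏ i, x i ^ a i) * (s - ∑ i, x i) ^ m)) := by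
        rw [integrable_indicator_iff (Sx_compact _ _).measurableSet]
        exact ContinuousOn.integrableOn_compact (Sx_compact _ _) (by fun_prop)
      exact (hme.integrable_comp_emb (MeasurableEquiv.measurableEmbedding _)).2 this

theorem stmt_16 (vert : Fin 4 → (Fin 3 → ℝ)) (hvert : AffineIndependent ℝ vert)
    (bc : (Fin 3 → ℝ) → (Fin 4 → ℝ))
    (hbc1 : ∀ v, ∑ i, bc v i = 1) (hbc2 : ∀ v, v = ∑ i, bc v i • vert i)
    (d : ℕ) (e e' : Fin 4 → ℕ)
    (he : ∑ i, e i = d) (he' : ∑ i, e' i = d) :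
    ∫ v in convexHull ℝ (Set.range vert),
        ((Nat.multinomial Finset.univ e : ℝ) * ∏ i, bc v i ^ e i) *
          ((Nat.multinomial Finset.univ e' : ℝ) * ∏ i, bc v i ^ e' i) =
      ((∏ i, ((e i + e' i).choose (e i)) : ℕ) : ℝ) /
          (((2 * d).choose d : ℝ) * ((2 * d + 3).choose 3 : ℝ)) *
        (volume (convexHull ℝ (Set.range vert))).toReal := by
  let A : (Fin 3 → ℝ) →L[ℝ] (Fin 3 → ℝ) :=
    ∑ j : Fin 3, (ContinuousLinearMap.proj (R := ℝ) (φ := fun _ : Fin 3 => ℝ) j).smulRight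
      (vert j.succ - vert 0)
  let φ : (Fin 3 → ℝ) → (Fin 3 → ℝ) := fun x => vert 0 + A x
  have hφ : ∀ x, φ x = ∑ i, (Fin.cons (1 - ∑ j, x j) x : Fin 4 → ℝ) i • vert i := by
    intro x
    simp only [φ, A, Fin.sum_univ_succ (n := 3), Fin.cons_zero, Fin.cons_succ]
    simp [Fin.sum_univ_three]
    module
  have huniq : ∀ w w' : Fin 4 → ℝ, ∑ i, w i = 1 → ∑ i, w' i = 1 →
      ∑ i, w i • vert i = ∑ i, w' i • vert i → w = w' := by
    intro w w' h h' h2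
    ext i
    have := affineIndependent_iff.1 hvert Finset.univ (w - w') (by simp [h, h'])
      (by simp [sub_smul, h2]) i (Finset.mem_univ _)
    simpa [sub_eq_zero] using this
  have hsum : ∀ x : Fin 3 → ℝ, ∑ i, (Fin.cons (1 - ∑ j, x j) x : Fin 4 → ℝ) i = 1 := by
    intro x
    simp [Fin.sum_univ_succ (n := 3)]
  have hbcφ : ∀ x, bc (φ x) = Fin.cons (1 - ∑ j, x j) x := by
    intro x
    apply huniq _ _ (hbc1 _) (hsum x)
    rw [← hbc2, hφ]
  have hinj : Function.Injective φ := by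
    intro x y hxy
    have := hbcφ x
    rw [hxy, hbcφ y] at this
    exact (Fin.cons_injective2 this).2.symm
  have himg : φ '' Sx 3 1 = convexHull ℝ (Set.range vert) := by
    rw [convexHull_range_eq_exists_affineCombination]
    ext v
    constructor
    · rintro ⟨x, hx, rfl⟩
      refine ⟨Finset.univ, Fin.cons (1 - ∑ j, x j) x, ?_, hsum x, ?_⟩
      · intro i _
        refine Fin.cases ?_ (fun j => ?_) i
        · simpa using hx.2
        · simpa using hx.1 j
      · rw [Finset.affineCombination_eq_linear_combination _ _ _ (hsum x), hφ]
    · rintro ⟨s, w, hw, hw1, rfl⟩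
      rw [Finset.affineCombination_eq_linear_combination _ _ _ hw1]
      let w' : Fin 4 → ℝ := fun i => if i ∈ s then w i else 0
      have hw'0 : ∀ i, 0 ≤ w' i := by
        intro i
        by_cases hi : i ∈ s
        · simpa [w', hi] using hw i hi
        · simp [w', hi]
      have hw'1 : ∑ i, w' i = 1 := by simpa [w'] using hw1
      have hh := hw'1
      rw [Fin.sum_univ_succ] at hh
      refine ⟨fun j => w' j.succ, ⟨fun j => hw'0 _, by linarith [hw'0 0]⟩, ?_⟩
      rw [hφ]
      have : (Fin.cons (1 - ∑ j : Fin 3, w' j.succ) (fun j => w' j.succ) : Fin 4 → ℝ) = w' := by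
        ext i
        refine Fin.cases ?_ (fun j => ?_) i
        · simp only [Fin.cons_zero]; linarith
        · simp
      rw [this]
      simp [w', ite_smul]
  have hcv : ∀ g : (Fin 3 → ℝ) → ℝ, ∫ v in convexHull ℝ (Set.range vert), g v
      = |A.det| * ∫ x in Sx 3 1, g (φ x) := by
    intro g
    rw [← himg, integral_image_eq_integral_abs_det_fderiv_smul (f' := fun _ => A) volume
      (Sx_compact 3 1).measurableSet
      (fun x _ => (A.hasFDerivAt.const_add (vert 0)).hasFDerivWithinAt) hinj.injOn]
    simp only [smul_eq_mul]
    rw [integral_const_mul]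
  have hmon : ∀ f : Fin 4 → ℕ, ∫ v in convexHull ℝ (Set.range vert), ∏ i, bc v i ^ f i
      = |A.det| * ((∏ i, (f i).factorial : ℕ) / ((∑ i, f i + 3).factorial : ℝ)) := by
    intro f
    rw [hcv]
    have := dirichlet 3 1 zero_le_one (fun j => f j.succ) (f 0)
    simp only [hbcφ, Fin.prod_univ_succ (n := 3), Fin.cons_zero, Fin.cons_succ,
      Fin.sum_univ_succ (n := 3)]
    simp only [one_pow, mul_one] at this
    rw [add_comm (f 0), Nat.cast_mul, mul_comm ((f 0).factorial : ℝ), ← this]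
    simp only [mul_comm]
  have hvol : (volume (convexHull ℝ (Set.range vert))).toReal = |A.det| / 6 := by
    have := hmon 0
    simp [measureReal_def, Nat.factorial] at this
    rw [this]; ring
  have hint : ∀ v, ((Nat.multinomial Finset.univ e : ℝ) * ∏ i, bc v i ^ e i) *
          ((Nat.multinomial Finset.univ e' : ℝ) * ∏ i, bc v i ^ e' i) =
      ((Nat.multinomial Finset.univ e : ℝ) * (Nat.multinomial Finset.univ e' : ℝ)) *
        ∏ i, bc v i ^ (e + e') i := by
    intro v
    simp only [Pi.add_apply, pow_add, Finset.prod_mul_distrib]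
    ring
  simp_rw [hint]
  rw [integral_const_mul, hmon, hvol]
  have hs : ∑ i, (e + e') i = 2 * d := by
    simp [Finset.sum_add_distrib, he, he']; ring
  rw [hs]
  have m1 : ((∏ i, (e i).factorial : ℕ) : ℝ) * (Nat.multinomial Finset.univ e : ℝ) = d.factorial := by
    rw [← he]; exact_mod_cast Nat.multinomial_spec Finset.univ e
  have m2 : ((∏ i, (e' i).factorial : ℕ) : ℝ) * (Nat.multinomial Finset.univ e' : ℝ)
      = d.factorial := by
    rw [← he']; exact_mod_cast Nat.multinomial_spec Finset.univ e'
  have m3 : ((∏ i, ((e i + e' i).choose (e i)) : ℕ) : ℝ) * (∏ i, (e i).factorial : ℕ) *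
      (∏ i, (e' i).factorial : ℕ) = (∏ i, ((e + e') i).factorial : ℕ) := by
    norm_cast
    rw [← Finset.prod_mul_distrib, ← Finset.prod_mul_distrib]
    refine Finset.prod_congr rfl fun i _ => ?_
    have := Nat.choose_mul_factorial_mul_factorial (Nat.le_add_right (e i) (e' i))
    simpa using this
  have m4 : ((2 * d).choose d : ℝ) * d.factorial * d.factorial = (2 * d).factorial := by
    have := Nat.choose_mul_factorial_mul_factorial (show d ≤ 2 * d by omega)
    rw [show 2 * d - d = d by omega] at this
    exact_mod_cast this
  have m5 : ((2 * d + 3).choose 3 : ℝ) * 6 * (2 * d).factorial = (2 * d + 3).factorial := by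
    have := Nat.choose_mul_factorial_mul_factorial (show 3 ≤ 2 * d + 3 by omega)
    rw [show 2 * d + 3 - 3 = 2 * d by omega] at this
    exact_mod_cast this
  have p1 : ((∏ i, (e i).factorial : ℕ) : ℝ) ≠ 0 := by
    exact_mod_cast Finset.prod_ne_zero_iff.2 fun i _ => Nat.factorial_ne_zero _
  have p2 : ((∏ i, (e' i).factorial : ℕ) : ℝ) ≠ 0 := by
    exact_mod_cast Finset.prod_ne_zero_iff.2 fun i _ => Nat.factorial_ne_zero _
  have p3 : ((2 * d).choose d : ℝ) ≠ 0 := by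
    exact_mod_cast (Nat.choose_pos (by omega)).ne'
  have p4 : ((2 * d + 3).choose 3 : ℝ) ≠ 0 := by
    exact_mod_cast (Nat.choose_pos (by omega)).ne'
  have p5 : (d.factorial : ℝ) ≠ 0 := by positivity
  rw [← m3, ← m5, ← m4]
  rw [mul_comm] at m1 m2
  rw [eq_div_of_mul_eq p1 m1, eq_div_of_mul_eq p2 m2]
  field_simp
end
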